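/- arXiv:2605.26917 — 5 statements merged into one kernel-verified Lean document; each statement's English description precedes it below -/
import Mathlib

section
/- Let R be a ring, let A and B be R-modules, let 𝒰 be an ultrafilter on ℕ, and let φ, ψ : ℕ → Hom_R(A, B) be two sequences of R-linear maps. If for every sequence a : ℕ → A the set {n ∈ ℕ : φ_n(a_n) = ψ_n(a_n)} belongs to 𝒰, then the set {n ∈ ℕ : φ_n = ψ_n} belongs to 𝒰. (Equivalently, the natural map from the ultraproduct of the Hom-modules 𝒰(Hom_R(A,B)) to Hom(𝒰(A), 𝒰(B)) is injective.) -/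
/-- Injectivity of the natural map `𝒰(Hom_R(A,B)) → Hom(𝒰(A), 𝒰(B))`: if two sequences of
`R`-linear maps `φ ψ : ℕ → Hom_R(A, B)` agree `𝒰`-often on every sequence `a : ℕ → A`,
then `φ n = ψ n` for `𝒰`-many `n`. -/
theorem ultraproduct_hom_injective (R : Type*) [Ring R] (A B : Type*)
    [AddCommGroup A] [AddCommGroup B] [Module R A] [Module R B]
    (𝒰 : Ultrafilter ℕ) (φ ψ : ℕ → (A →ₗ[R] B))
    (h : ∀ a : ℕ → A, {n : ℕ | φ n (a n) = ψ n (a n)} ∈ 𝒰) :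
    {n : ℕ | φ n = ψ n} ∈ 𝒰 := by
  have key : ∀ n, ∃ x : A, φ n x = ψ n x → φ n = ψ n := by
    intro n
    by_cases hn : φ n = ψ n
    · exact ⟨0, fun _ => hn⟩
    · obtain ⟨x, hx⟩ := DFunLike.exists_ne hn
      exact ⟨x, fun e => absurd e hx⟩
  choose a ha using key
  exact Filter.mem_of_superset (h a) (fun n hn => ha n hn)
end

section
/- Let K be a number field with ring of integers 𝓞_K and let 𝒰 be an ultrafilter on ℕ. Let s, t be natural numbers and let u : Fin s → (ℕ → Ideal 𝓞_K) and q : Fin t → (ℕ → Ideal 𝓞_K) be families of sequences of ideals such that every u_i(k) and every q_j(k) is a nonzero prime ideal of 𝓞_K. If the set {k ∈ ℕ : ∏_{i} u_i(k) = ∏_{j} q_j(k)} belongs to 𝒰, then s = t and there exists a bijection σ : Fin s → Fin t such that for every i the set {k ∈ ℕ : u_i(k) = q_{σ(i)}(k)} belongs to 𝒰. -/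
theorem exists_equiv_of_map_eq {α β γ : Type*} [Fintype α] [Fintype β] (f : α → γ) (g : β → γ)
    (h : Multiset.map f Finset.univ.val = Multiset.map g Finset.univ.val) :
    ∃ σ : α ≃ β, ∀ i, f i = g (σ i) := by
  classical
  have hc : ∀ c, Nonempty ({a // f a = c} ≃ {b // g b = c}) := by
    intro c
    have := congrArg (Multiset.count c) h
    rw [Multiset.count_map, Multiset.count_map] at this
    refine ⟨Fintype.equivOfCardEq ?_⟩
    rw [Fintype.card_subtype, Fintype.card_subtype]
    simp only [eq_comm (a := c)] at this
    exact this
  have e := fun c => Classical.choice (hc c)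
  refine ⟨(Equiv.sigmaFiberEquiv f).symm.trans
    ((Equiv.sigmaCongrRight e).trans (Equiv.sigmaFiberEquiv g)), fun i => ?_⟩
  exact ((e (f i)) ⟨i, rfl⟩).2.symm


/-- **Uniqueness of ultraprime factorization.** Let `K` be a number field with ring of
integers `𝓞 K` and `𝒰` an ultrafilter on `ℕ`. If two families of sequences of nonzero prime
ideals `u : Fin s → ℕ → Ideal (𝓞 K)` and `q : Fin t → ℕ → Ideal (𝓞 K)` have
`𝒰`-often equal products, then `s = t` and, after a bijection `σ : Fin s ≃ Fin t`,
the factors are pairwise `𝒰`-equivalent. -/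
theorem ultraprime_factorization_unique (K : Type*) [Field K] [NumberField K]
    (𝒰 : Ultrafilter ℕ) (s t : ℕ)
    (u : Fin s → ℕ → Ideal (NumberField.RingOfIntegers K))
    (q : Fin t → ℕ → Ideal (NumberField.RingOfIntegers K))
    (hu : ∀ i k, u i k ≠ ⊥ ∧ (u i k).IsPrime)
    (hq : ∀ j k, q j k ≠ ⊥ ∧ (q j k).IsPrime)
    (h : {k : ℕ | ∏ i, u i k = ∏ j, q j k} ∈ 𝒰) :
    s = t ∧ ∃ σ : Fin s ≃ Fin t, ∀ i, {k : ℕ | u i k = q (σ i) k} ∈ 𝒰 := by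
  have key : ∀ k, ∏ i, u i k = ∏ j, q j k → ∃ σ : Fin s ≃ Fin t, ∀ i, u i k = q (σ i) k := by
    intro k hk
    have hm : Multiset.map (fun i => u i k) Finset.univ.val
        = Multiset.map (fun j => q j k) Finset.univ.val := by
      rw [← Multiset.rel_eq]
      have := prime_factors_unique (f := Multiset.map (fun i => u i k) Finset.univ.val)
        (g := Multiset.map (fun j => q j k) Finset.univ.val)
        (by
          intro x hx
          obtain ⟨i, -, rfl⟩ := Multiset.mem_map.1 hx
          exact Ideal.prime_of_isPrime (hu i k).1 (hu i k).2)
        (by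
          intro x hx
          obtain ⟨i, -, rfl⟩ := Multiset.mem_map.1 hx
          exact Ideal.prime_of_isPrime (hq i k).1 (hq i k).2)
        (Associated.of_eq hk)
      exact this.mono (fun a _ b _ hab => associated_iff_eq.1 hab)
    exact exists_equiv_of_map_eq _ _ hm
  have h2 : ∀ᶠ k in (𝒰 : Filter ℕ), ∃ σ : Fin s ≃ Fin t, ∀ i, u i k = q (σ i) k :=
    Filter.mem_of_superset h key
  obtain ⟨σ, hσ⟩ := Ultrafilter.eventually_exists_iff.1 h2
  exact ⟨by simpa using Fintype.card_congr σ, σ, fun i => hσ.mono fun k hk => hk i⟩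
end

section
/- Let K be a number field with ring of integers 𝓞_K, let 𝒰 be an ultrafilter on ℕ, let n : ℕ → Ideal 𝓞_K be a sequence of ideals, and let B be a natural number. Suppose the set of k ∈ ℕ for which there exists a multiset m of nonzero prime ideals of 𝓞_K with card(m) ≤ B and n(k) = ∏ m belongs to 𝒰. Then there exist s ≤ B and sequences ℓ_1, …, ℓ_s : ℕ → Ideal 𝓞_K such that the set {k ∈ ℕ : each ℓ_j(k) is a nonzero prime ideal and n(k) = ∏_{j} ℓ_j(k)} belongs to 𝒰. If moreover the set {k ∈ ℕ : n(k) is squarefree in the monoid of ideals of 𝓞_K} belongs to 𝒰, then the ℓ_j can be chosen so that for all i ≠ j the set {k ∈ ℕ : ℓ_i(k) = ℓ_j(k)} does not belong to 𝒰. -/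
/-- **Existence of ultraprime factorizations.** Let `K` be a number field, `𝒰` an ultrafilter
on `ℕ`, and `n : ℕ → Ideal (𝓞 K)` a sequence of ideals such that `𝒰`-often `n k` is a product
of at most `B` nonzero prime ideals (counted with multiplicity). Then there are `s ≤ B` and
sequences `ℓ 0, …, ℓ (s-1)` such that `𝒰`-often each `ℓ j k` is a nonzero prime ideal and
`n k = ∏ j, ℓ j k`; moreover, if `n k` is `𝒰`-often squarefree, then the `ℓ j` are pairwise
`𝒰`-inequivalent. -/
theorem ultraprime_factorization_exists (K : Type*) [Field K] [NumberField K]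
    (𝒰 : Ultrafilter ℕ) (n : ℕ → Ideal (NumberField.RingOfIntegers K)) (B : ℕ)
    (h : {k : ℕ | ∃ m : Multiset (Ideal (NumberField.RingOfIntegers K)),
        (∀ P ∈ m, P ≠ ⊥ ∧ P.IsPrime) ∧ Multiset.card m ≤ B ∧ n k = m.prod} ∈ 𝒰) :
    ∃ s ≤ B, ∃ ℓ : Fin s → ℕ → Ideal (NumberField.RingOfIntegers K),
      {k : ℕ | (∀ j, ℓ j k ≠ ⊥ ∧ (ℓ j k).IsPrime) ∧ n k = ∏ j, ℓ j k} ∈ 𝒰 ∧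
      ({k : ℕ | Squarefree (n k)} ∈ 𝒰 →
        ∀ i j, i ≠ j → {k : ℕ | ℓ i k = ℓ j k} ∉ 𝒰) := by
  classical
  have h2 : (⋃ s ∈ Set.Iic B, {k : ℕ | ∃ f : Fin s → Ideal (NumberField.RingOfIntegers K),
      (∀ j, f j ≠ ⊥ ∧ (f j).IsPrime) ∧ n k = ∏ j, f j}) ∈ 𝒰 := by
    refine Filter.mem_of_superset h ?_
    rintro k ⟨m, hm, hc, hn⟩
    induction m using Quotient.inductionOn with
    | h l =>
      simp only [Set.mem_iUnion]
      refine ⟨l.length, by simpa using hc, fun j => l.get j, fun j => hm _ (by simp), ?_⟩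
      rw [hn]
      simp [← List.prod_ofFn]
  rw [Ultrafilter.finite_biUnion_mem_iff (Set.finite_Iic B)] at h2
  obtain ⟨s, hs, h3⟩ := h2
  have hch : ∀ k : ℕ, ∃ f : Fin s → Ideal (NumberField.RingOfIntegers K),
      (∃ f : Fin s → Ideal (NumberField.RingOfIntegers K),
        (∀ j, f j ≠ ⊥ ∧ (f j).IsPrime) ∧ n k = ∏ j, f j) →
      (∀ j, f j ≠ ⊥ ∧ (f j).IsPrime) ∧ n k = ∏ j, f j := by
    intro k
    by_cases hk : ∃ f : Fin s → Ideal (NumberField.RingOfIntegers K),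
        (∀ j, f j ≠ ⊥ ∧ (f j).IsPrime) ∧ n k = ∏ j, f j
    · obtain ⟨f, hf⟩ := hk
      exact ⟨f, fun _ => hf⟩
    · exact ⟨fun _ => ⊥, fun h => absurd h hk⟩
  choose f hf using hch
  have h4 : {k : ℕ | (∀ j, f k j ≠ ⊥ ∧ (f k j).IsPrime) ∧ n k = ∏ j, f k j} ∈ 𝒰 :=
    Filter.mem_of_superset h3 fun k hk => hf k hk
  refine ⟨s, hs, fun j k => f k j, h4, ?_⟩
  intro hsq i j hij heq
  obtain ⟨k, ⟨hk1, hk2⟩, hk3⟩ :=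
    Ultrafilter.nonempty_of_mem (Filter.inter_mem (Filter.inter_mem h4 hsq) heq)
  obtain ⟨hp, hprod⟩ := hk1
  have hk3' : f k i = f k j := hk3
  have hd : f k i * f k i ∣ n k := by
    rw [hprod, ← Finset.mul_prod_erase Finset.univ (f k) (Finset.mem_univ i)]
    refine mul_dvd_mul_left _ ?_
    rw [hk3']
    exact Finset.dvd_prod_of_mem (f k) (Finset.mem_erase.2 ⟨hij.symm, Finset.mem_univ j⟩)
  have hu := hk2 _ hd
  exact (hp i).2.ne_top (Ideal.isUnit_iff.1 hu)
end

section
/- Let p be a prime number, let Λ = ℤ_p⟦X⟧ be the ring of formal power series over the p-adic integers, and for k ≥ 1 let Λ_k = Λ/(p^k, X^k). Then the set of elements of Λ_k annihilated by both the image of p and the image of X is exactly the ideal of Λ_k generated by the image of p^{k−1}·X^{k−1}; in particular this annihilator has exactly p elements, i.e., it is a one-dimensional vector space over the residue field 𝔽_p. -/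
/-- The ideal `(p^k, X^k)` of the Iwasawa algebra `Λ = ℤ_p⟦X⟧`. -/
noncomputable def iwasawaIk (p : ℕ) [Fact p.Prime] (k : ℕ) : Ideal (PowerSeries ℤ_[p]) :=
  Ideal.span {(p : PowerSeries ℤ_[p]) ^ k, (PowerSeries.X : PowerSeries ℤ_[p]) ^ k}

lemma iwasawa_mem_iff (p : ℕ) [Fact p.Prime] (k : ℕ) (f : PowerSeries ℤ_[p]) :
    f ∈ iwasawaIk p k ↔ ∀ i < k, (p : ℤ_[p]) ^ k ∣ PowerSeries.coeff i f := by
  have hC : (p : PowerSeries ℤ_[p]) ^ k = PowerSeries.C ((p : ℤ_[p]) ^ k) := by simp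
  unfold iwasawaIk
  rw [Ideal.mem_span_pair, hC]
  constructor
  · rintro ⟨a, b, rfl⟩ i hi
    rw [map_add, PowerSeries.coeff_mul_C, PowerSeries.coeff_mul_X_pow', if_neg (by omega), add_zero]
    exact dvd_mul_left _ _
  · intro h
    choose g hg using h
    refine ⟨PowerSeries.mk fun i => if hi : i < k then g i hi else 0,
      PowerSeries.mk fun i => PowerSeries.coeff (i + k) f, ?_⟩
    ext i
    rw [map_add, PowerSeries.coeff_mul_C, PowerSeries.coeff_mul_X_pow', PowerSeries.coeff_mk]
    by_cases hi : i < k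
    · rw [dif_pos hi, if_neg (by omega), hg i hi]; ring
    · rw [dif_neg hi, if_pos (by omega), PowerSeries.coeff_mk, Nat.sub_add_cancel (by omega)]; ring

lemma iwasawa_coeff_aux (p : ℕ) [Fact p.Prime] (n i : ℕ) (F : PowerSeries ℤ_[p]) :
    PowerSeries.coeff i ((p : PowerSeries ℤ_[p]) ^ n * F) = (p : ℤ_[p]) ^ n * PowerSeries.coeff i F := by
  have hC : (p : PowerSeries ℤ_[p]) ^ n = PowerSeries.C ((p : ℤ_[p]) ^ n) := by simp
  rw [hC, PowerSeries.coeff_C_mul]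

lemma iwasawa_socle_iff (p : ℕ) [Fact p.Prime] (n : ℕ) (F : PowerSeries ℤ_[p]) :
    ((p : PowerSeries ℤ_[p]) * F ∈ iwasawaIk p (n+1) ∧ PowerSeries.X * F ∈ iwasawaIk p (n+1)) ↔
    ((∀ i < n, (p : ℤ_[p]) ^ (n+1) ∣ PowerSeries.coeff i F) ∧
      (p : ℤ_[p]) ^ n ∣ PowerSeries.coeff n F) := by
  have hp : (p : ℤ_[p]) ≠ 0 := by exact_mod_cast (Fact.out : p.Prime).ne_zero
  have h1 := fun i => iwasawa_coeff_aux p 1 i F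
  simp only [pow_one] at h1
  rw [iwasawa_mem_iff, iwasawa_mem_iff]
  simp only [h1]
  constructor
  · rintro ⟨ha, hb⟩
    refine ⟨fun i hi => ?_, ?_⟩
    · have := hb (i+1) (by omega)
      rwa [PowerSeries.coeff_succ_X_mul] at this
    · have := ha n (by omega)
      rw [pow_succ'] at this
      exact (mul_dvd_mul_iff_left hp).1 this
  · rintro ⟨ha, hb⟩
    refine ⟨fun i hi => ?_, fun i hi => ?_⟩
    · rcases Nat.lt_succ_iff_lt_or_eq.1 hi with h | rfl
      · exact (ha i h).mul_left _
      · rw [pow_succ']; exact mul_dvd_mul_left _ hb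
    · cases i with
      | zero => simp
      | succ i => rw [PowerSeries.coeff_succ_X_mul]; exact ha i (by omega)

/-- The map `c ↦ c p^n X^n` into the quotient. -/
noncomputable def iwasawaPsi (p : ℕ) [Fact p.Prime] (n : ℕ) :
    ℤ_[p] →+ PowerSeries ℤ_[p] ⧸ iwasawaIk p (n+1) :=
  (Ideal.Quotient.mk (iwasawaIk p (n+1))).toAddMonoidHom.comp
    ((AddMonoidHom.mulLeft ((p : PowerSeries ℤ_[p]) ^ n * PowerSeries.X ^ n)).comp
      (PowerSeries.C (R := ℤ_[p])).toAddMonoidHom)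

lemma iwasawaPsi_apply (p : ℕ) [Fact p.Prime] (n : ℕ) (c : ℤ_[p]) :
    iwasawaPsi p n c = Ideal.Quotient.mk (iwasawaIk p (n+1))
      ((p : PowerSeries ℤ_[p]) ^ n * PowerSeries.X ^ n * PowerSeries.C c) := rfl

lemma iwasawa_coeff_gen (p : ℕ) [Fact p.Prime] (n i : ℕ) (G : PowerSeries ℤ_[p]) :
    PowerSeries.coeff i ((p : PowerSeries ℤ_[p]) ^ n * PowerSeries.X ^ n * G) =
      if n ≤ i then (p : ℤ_[p]) ^ n * PowerSeries.coeff (i - n) G else 0 := by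
  rw [mul_assoc, iwasawa_coeff_aux, PowerSeries.coeff_X_pow_mul']
  split_ifs <;> simp

lemma iwasawa_ker (p : ℕ) [Fact p.Prime] (n : ℕ) :
    (iwasawaPsi p n).ker = (PadicInt.toZMod (p := p)).toAddMonoidHom.ker := by
  have hp : (p : ℤ_[p]) ≠ 0 := by exact_mod_cast (Fact.out : p.Prime).ne_zero
  ext c
  have h2 : c ∈ (PadicInt.toZMod (p := p)).toAddMonoidHom.ker ↔ (p : ℤ_[p]) ∣ c := by
    rw [← Ideal.mem_span_singleton, ← PadicInt.maximalIdeal_eq_span_p, ← PadicInt.ker_toZMod]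
    rfl
  rw [h2, AddMonoidHom.mem_ker, iwasawaPsi_apply, Ideal.Quotient.eq_zero_iff_mem, iwasawa_mem_iff]
  simp only [iwasawa_coeff_gen]
  constructor
  · intro h
    have := h n (by omega)
    simp only [le_refl, if_true, Nat.sub_self, PowerSeries.coeff_zero_C, pow_succ] at this
    exact (mul_dvd_mul_iff_left (pow_ne_zero n hp)).1 this
  · intro h i hi
    split_ifs with hn
    · obtain rfl : i = n := by omega
      simp only [Nat.sub_self, PowerSeries.coeff_zero_C, pow_succ]
      exact mul_dvd_mul_left _ h
    · simp

lemma iwasawa_range (p : ℕ) [Fact p.Prime] (n : ℕ) (F : PowerSeries ℤ_[p])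
    (h : (∀ i < n, (p : ℤ_[p]) ^ (n+1) ∣ PowerSeries.coeff i F) ∧
      (p : ℤ_[p]) ^ n ∣ PowerSeries.coeff n F) :
    ∃ c, iwasawaPsi p n c = Ideal.Quotient.mk (iwasawaIk p (n+1)) F := by
  obtain ⟨ha, c, hc⟩ := h
  refine ⟨c, ?_⟩
  rw [iwasawaPsi_apply, Ideal.Quotient.eq, iwasawa_mem_iff]
  intro i hi
  rw [map_sub, iwasawa_coeff_gen]
  rcases Nat.lt_succ_iff_lt_or_eq.1 hi with h | rfl
  · rw [if_neg (by omega), zero_sub]; exact (dvd_neg).2 (ha i h)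
  · simp [hc]

lemma iwasawa_gen_socle (p : ℕ) [Fact p.Prime] (n : ℕ) (G : PowerSeries ℤ_[p]) :
    (∀ i < n, (p : ℤ_[p]) ^ (n+1) ∣
      PowerSeries.coeff i ((p : PowerSeries ℤ_[p]) ^ n * PowerSeries.X ^ n * G)) ∧
      (p : ℤ_[p]) ^ n ∣
        PowerSeries.coeff n ((p : PowerSeries ℤ_[p]) ^ n * PowerSeries.X ^ n * G) := by
  refine ⟨fun i hi => ?_, ?_⟩
  · rw [iwasawa_coeff_gen, if_neg (by omega)]; exact dvd_zero _
  · rw [iwasawa_coeff_gen, if_pos le_rfl]; exact dvd_mul_right _ _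

lemma iwasawa_socle_iff' (p : ℕ) [Fact p.Prime] (n : ℕ) (F : PowerSeries ℤ_[p]) :
    ((p : PowerSeries ℤ_[p] ⧸ iwasawaIk p (n+1)) * Ideal.Quotient.mk (iwasawaIk p (n+1)) F = 0 ∧
      Ideal.Quotient.mk (iwasawaIk p (n+1)) PowerSeries.X *
        Ideal.Quotient.mk (iwasawaIk p (n+1)) F = 0) ↔
    ((∀ i < n, (p : ℤ_[p]) ^ (n+1) ∣ PowerSeries.coeff i F) ∧
      (p : ℤ_[p]) ^ n ∣ PowerSeries.coeff n F) := by
  rw [← iwasawa_socle_iff, ← Ideal.Quotient.eq_zero_iff_mem, ← Ideal.Quotient.eq_zero_iff_mem,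
    map_mul, map_mul, map_natCast]

/-- In `Λ_k = ℤ_p⟦X⟧/(p^k, X^k)`, the set of elements annihilated by both (the images of)
`p` and `X` is exactly the ideal generated by the image of `p^(k-1) * X^(k-1)`; in
particular it has exactly `p` elements. -/
theorem iwasawa_quotient_socle (p : ℕ) [Fact p.Prime] (k : ℕ) (hk : 1 ≤ k) :
    (∀ f : PowerSeries ℤ_[p] ⧸ iwasawaIk p k,
        ((p : PowerSeries ℤ_[p] ⧸ iwasawaIk p k) * f = 0 ∧
          Ideal.Quotient.mk (iwasawaIk p k) PowerSeries.X * f = 0) ↔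
        f ∈ Ideal.span {Ideal.Quotient.mk (iwasawaIk p k)
            ((p : PowerSeries ℤ_[p]) ^ (k - 1) * PowerSeries.X ^ (k - 1))}) ∧
    Nat.card {f : PowerSeries ℤ_[p] ⧸ iwasawaIk p k |
        (p : PowerSeries ℤ_[p] ⧸ iwasawaIk p k) * f = 0 ∧
          Ideal.Quotient.mk (iwasawaIk p k) PowerSeries.X * f = 0} = p := by
  obtain ⟨n, rfl⟩ : ∃ n, k = n + 1 := ⟨k - 1, by omega⟩
  rw [Nat.add_sub_cancel]
  constructor
  · intro f
    obtain ⟨F, rfl⟩ := Ideal.Quotient.mk_surjective f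
    rw [iwasawa_socle_iff', Ideal.mem_span_singleton]
    constructor
    · intro h
      obtain ⟨c, hc⟩ := iwasawa_range p n F h
      rw [← hc, iwasawaPsi_apply]
      exact ⟨_, map_mul _ _ _⟩
    · rintro ⟨g, hg⟩
      obtain ⟨G, rfl⟩ := Ideal.Quotient.mk_surjective g
      rw [← iwasawa_socle_iff', hg, ← map_mul, iwasawa_socle_iff']
      exact iwasawa_gen_socle p n G
  · have hS : {f : PowerSeries ℤ_[p] ⧸ iwasawaIk p (n+1) |
        (p : PowerSeries ℤ_[p] ⧸ iwasawaIk p (n+1)) * f = 0 ∧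
          Ideal.Quotient.mk (iwasawaIk p (n+1)) PowerSeries.X * f = 0} =
        ((iwasawaPsi p n).range : Set _) := by
      ext f
      obtain ⟨F, rfl⟩ := Ideal.Quotient.mk_surjective f
      rw [Set.mem_ofPred_eq]
      constructor
      · intro h
        exact iwasawa_range p n F ((iwasawa_socle_iff' p n F).1 h)
      · rintro ⟨c, hc⟩
        rw [← hc, iwasawaPsi_apply, iwasawa_socle_iff']
        exact iwasawa_gen_socle p n _
    rw [hS]
    have e1 := QuotientAddGroup.quotientKerEquivRange (iwasawaPsi p n)
    have e2 := QuotientAddGroup.quotientAddEquivOfEq (iwasawa_ker p n)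
    have e3 := QuotientAddGroup.quotientKerEquivOfSurjective
      (PadicInt.toZMod (p := p)).toAddMonoidHom (ZMod.ringHom_surjective (PadicInt.toZMod (p := p)))
    exact (Nat.card_congr (e1.symm.trans (e2.trans e3)).toEquiv).trans (Nat.card_zmod p)
end

section
/- Let p be a prime number and Λ = ℤ_p⟦X⟧. For natural numbers m ≤ n, the set of elements f of Λ_n = Λ/(p^n, X^n) satisfying p^m·f = 0 and X^m·f = 0 is exactly the principal ideal of Λ_n generated by the image of p^{n−m}·X^{n−m}. -/
theorem aux_ann {R : Type*} [CommRing R] [IsDomain R] (q x : R) (hx : Prime x) (hq : ¬ x ∣ q)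
    (m k : ℕ) (f : R)
    (h1 : ∃ a b, a * q ^ (m + k) + b * x ^ (m + k) = q ^ m * f)
    (h2 : ∃ a b, a * q ^ (m + k) + b * x ^ (m + k) = x ^ m * f) :
    ∃ e c d, f = e * (q ^ k * x ^ k) + (d * q ^ (m + k) + c * x ^ (m + k)) := by
  have key : ∀ i j g, x ^ i ∣ q ^ j * g → x ^ i ∣ g := fun i j g h =>
    hx.pow_dvd_of_dvd_mul_left i (fun h' => hq (hx.dvd_of_dvd_pow h')) h
  obtain ⟨a, b, h1⟩ := h1
  obtain ⟨a', b', h2⟩ := h2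
  obtain ⟨c, hc⟩ := key (m + k) m (f - q ^ k * a) ⟨b, by rw [pow_add q] at h1; linear_combination -h1⟩
  have h3 : x ^ (m + k) ∣ x ^ m * a - q ^ m * a' := by
    apply key _ k
    refine ⟨b' - x ^ m * c, ?_⟩
    rw [pow_add q] at h2
    linear_combination -h2 - x ^ m * hc
  obtain ⟨t, ht⟩ := h3
  obtain ⟨d, hd⟩ := key m m a' ⟨a - x ^ k * t, by rw [pow_add] at ht; linear_combination -ht⟩
  have h4 : a - q ^ m * d = x ^ k * t := by
    apply mul_left_cancel₀ (pow_ne_zero m hx.ne_zero)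
    rw [pow_add] at ht
    linear_combination ht + q ^ m * hd
  refine ⟨t, c, d, ?_⟩
  rw [pow_add q]
  linear_combination hc + q ^ k * h4

/-- For `m ≤ n`, the annihilator `Λ_n[(p^m, X^m)]` of the ideal `(p^m, X^m)` in
`Λ_n = ℤ_p⟦X⟧/(p^n, X^n)` is the principal ideal generated by the image of
`p^(n-m) * X^(n-m)`. -/
theorem iwasawa_quotient_ann_principal (p : ℕ) [Fact p.Prime] (m n : ℕ) (hmn : m ≤ n) :
    ∀ f : PowerSeries ℤ_[p] ⧸ iwasawaIk p n,
      ((p : PowerSeries ℤ_[p] ⧸ iwasawaIk p n) ^ m * f = 0 ∧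
        (Ideal.Quotient.mk (iwasawaIk p n) PowerSeries.X) ^ m * f = 0) ↔
      f ∈ Ideal.span {Ideal.Quotient.mk (iwasawaIk p n)
          ((p : PowerSeries ℤ_[p]) ^ (n - m) * PowerSeries.X ^ (n - m))} := by
  intro f
  obtain ⟨f, rfl⟩ := Ideal.Quotient.mk_surjective f
  obtain ⟨k, rfl⟩ := Nat.exists_eq_add_of_le hmn
  have hX : Prime (PowerSeries.X : PowerSeries ℤ_[p]) := PowerSeries.X_prime
  have hq : ¬ (PowerSeries.X : PowerSeries ℤ_[p]) ∣ (p : PowerSeries ℤ_[p]) := by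
    rw [PowerSeries.X_dvd_iff, map_natCast]
    exact_mod_cast (Fact.out : p.Prime).ne_zero
  rw [← map_natCast (Ideal.Quotient.mk (iwasawaIk p (m + k))), ← map_pow, ← map_pow, ← map_mul,
    ← map_mul, Ideal.Quotient.eq_zero_iff_mem, Ideal.Quotient.eq_zero_iff_mem,
    Nat.add_sub_cancel_left, Ideal.mem_span_singleton']
  constructor
  · rintro ⟨h1, h2⟩
    obtain ⟨e, c, d, h⟩ := aux_ann _ _ hX hq m k f (Ideal.mem_span_pair.1 h1)
      (Ideal.mem_span_pair.1 h2)
    refine ⟨Ideal.Quotient.mk _ e, ?_⟩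
    rw [← map_mul, eq_comm, Ideal.Quotient.eq]
    exact Ideal.mem_span_pair.2 ⟨d, c, by rw [h]; ring⟩
  · rintro ⟨e, he⟩
    obtain ⟨e, rfl⟩ := Ideal.Quotient.mk_surjective e
    rw [← map_mul, eq_comm, Ideal.Quotient.eq] at he
    obtain ⟨a, b, h⟩ := Ideal.mem_span_pair.1 he
    have hf := eq_add_of_sub_eq h.symm
    constructor
    · refine Ideal.mem_span_pair.2 ⟨(p : PowerSeries ℤ_[p]) ^ m * a + e * PowerSeries.X ^ k,
        (p : PowerSeries ℤ_[p]) ^ m * b, ?_⟩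
      rw [hf]; ring
    · refine Ideal.mem_span_pair.2 ⟨PowerSeries.X ^ m * a,
        PowerSeries.X ^ m * b + e * (p : PowerSeries ℤ_[p]) ^ k, ?_⟩
      rw [hf]; ring
end
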